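/- arXiv:1201.2571 — 12 statements merged into one kernel-verified Lean document; each statement's English description precedes it below -/
import Mathlib

section
/- There exist partial recursive functions u and v such that for every function f : Set ℕ → Set ℕ and every d ∈ E(f): u(d) is defined and u(d) ∈ ⋂_{p ⊆ ℕ} (L(f)(p) → L'(f)(p)), and v(d) is defined and v(d) ∈ ⋂_{p ⊆ ℕ} (L'(f)(p) → L(f)(p)). (That is, the Pitts-style least-fixed-point operator L' is isomorphic to the second-order operator L, uniformly in a realizer of monotonicity of f.) -/
open scoped Classical

/-- Kleene application: value of the `e`-th partial recursive function at `x`. -/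
def kleene (e x : ℕ) : Part ℕ := (Denumerable.ofNat Nat.Partrec.Code e).eval x

/-- `A ∧ B = {⟨a,b⟩ | a ∈ A, b ∈ B}`. -/
def setAnd (A B : Set ℕ) : Set ℕ := {x | ∃ a ∈ A, ∃ b ∈ B, x = Nat.pair a b}

/-- `A → B = {e | ∀ a ∈ A, e·a is defined and e·a ∈ B}`. -/
def setImp (A B : Set ℕ) : Set ℕ := {e | ∀ a ∈ A, ∃ v ∈ kleene e a, v ∈ B}

/-- `E(f) = ⋂_{p,q} ((p → q) → (f p → f q))`. -/
def Efun (f : Set ℕ → Set ℕ) : Set ℕ :=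
  ⋂ (p : Set ℕ) (q : Set ℕ), setImp (setImp p q) (setImp (f p) (f q))

/-- `L(f)(p) = ⋂_q (((p → q) ∧ (f q → q)) → q)`. -/
def Lop (f : Set ℕ → Set ℕ) (p : Set ℕ) : Set ℕ :=
  ⋂ (q : Set ℕ), setImp (setAnd (setImp p q) (setImp (f q) q)) q

/-- `L'(f)(p) = ⋂ {q | {0} ∧ p ⊆ q and {1} ∧ f q ⊆ q}`. -/
def L' (f : Set ℕ → Set ℕ) (p : Set ℕ) : Set ℕ :=
  ⋂₀ {q : Set ℕ | setAnd {0} p ⊆ q ∧ setAnd {1} (f q) ⊆ q}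

/-- A sight: either `NIL` or a pair `(A, σ)` with `σ` assigning a sight to each `a ∈ A`. -/
inductive Sight : Type
  | nil : Sight
  | node (A : Set ℕ) (σ : (a : ℕ) → a ∈ A → Sight) : Sight

/-- `S` is a `(z,θ,p)`-dedicated sight. -/
def Dedicated (B : Set ℕ) (θ : ℕ → Set (Set ℕ)) (p : Set ℕ) : ℕ → Sight → Prop
  | z, .nil => ∃ y ∈ p, z = Nat.pair 0 y
  | z, .node A σ => ∃ n ∈ B, ∃ e : ℕ, z = Nat.pair 1 (Nat.pair n e) ∧ A ∈ θ n ∧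
      ∀ a (ha : a ∈ A), ∃ v ∈ kleene e a, Dedicated B θ p v (σ a ha)

/-- The tree `Tr(S)` of a sight, as a predicate on (finite) sequences. -/
inductive InTr : Sight → List ℕ → Prop
  | nil : InTr Sight.nil []
  | emptyNode (A : Set ℕ) (σ : (a : ℕ) → a ∈ A → Sight) (hA : A = ∅) :
      InTr (Sight.node A σ) []
  | cons (A : Set ℕ) (σ : (a : ℕ) → a ∈ A → Sight) (a : ℕ) (ha : a ∈ A)
      (t : List ℕ) (h : InTr (σ a ha) t) : InTr (Sight.node A σ) (a :: t)

/-- The good leaves of (the tree of) a sight. -/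
inductive IsGoodLeaf : Sight → List ℕ → Prop
  | nil : IsGoodLeaf Sight.nil []
  | cons (A : Set ℕ) (σ : (a : ℕ) → a ∈ A → Sight) (a : ℕ) (ha : a ∈ A)
      (t : List ℕ) (h : IsGoodLeaf (σ a ha) t) : IsGoodLeaf (Sight.node A σ) (a :: t)

/-- `s` is a leaf of `Tr(S)`. -/
def IsLeaf (S : Sight) (s : List ℕ) : Prop := InTr S s ∧ ∀ a : ℕ, ¬ InTr S (s ++ [a])

/-- `Out_S(s) = {a | s∗⟨a⟩ ∈ Tr(S)}`. -/
def OutS (S : Sight) (s : List ℕ) : Set ℕ := {a | InTr S (s ++ [a])}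

/-- A sight is degenerate if some leaf of its tree is not a good leaf. -/
def Degenerate (S : Sight) : Prop := ∃ s, IsLeaf S s ∧ ¬ IsGoodLeaf S s

/-- A sight is on a family `𝒜` if all its outsets at non-leaves belong to `𝒜`. -/
def SightOn (S : Sight) (𝒜 : Set (Set ℕ)) : Prop :=
  ∀ s, InTr S s → ¬ IsLeaf S s → OutS S s ∈ 𝒜

/-- `S` is `(w,θ,p)`-supporting. -/
def Supporting (B : Set ℕ) (θ : ℕ → Set (Set ℕ)) (p : Set ℕ) (w : ℕ) (S : Sight) : Prop :=
  (∀ s, IsGoodLeaf S s → ∃ y ∈ p, Nat.pair 0 y ∈ kleene w (Encodable.encode s)) ∧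
  (∀ s, InTr S s → ¬ IsGoodLeaf S s →
    ∃ n ∈ B, Nat.pair 1 n ∈ kleene w (Encodable.encode s) ∧ OutS S s ∈ θ n)

/-- `z` is r-defined on `S` if `S` is `(z,θ,ℕ)`-dedicated for some `θ`. -/
def RDefined (z : ℕ) (S : Sight) : Prop :=
  ∃ (B : Set ℕ) (θ : ℕ → Set (Set ℕ)), B.Nonempty ∧ (∀ n ∈ B, (θ n).Nonempty) ∧
    Dedicated B θ Set.univ z S

/-- `G_θ(p) = {⟨n,e⟩ | n ∈ B, e ∈ (A → p) for some A ∈ θ(n)}`. -/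
def Gtheta (B : Set ℕ) (θ : ℕ → Set (Set ℕ)) (p : Set ℕ) : Set ℕ :=
  {z | ∃ n ∈ B, ∃ e, z = Nat.pair n e ∧ ∃ A ∈ θ n, e ∈ setImp A p}

/-- `G_𝒜(p) = ⋃_{A ∈ 𝒜} (A → p)`. -/
def GA (𝒜 : Set (Set ℕ)) (p : Set ℕ) : Set ℕ := ⋃ A ∈ 𝒜, setImp A p

/-- `𝒜 ≤_L ℬ`: the ordering of basic local operators. -/
def leL (𝒜 ℬ : Set (Set ℕ)) : Prop := ∃ z : ℕ, ∀ A ∈ 𝒜, z ∈ L' (GA ℬ) A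

/-- `𝒜` has the `n`-intersection property. -/
def nIntProp (𝒜 : Set (Set ℕ)) (n : ℕ) : Prop :=
  ∀ A : Fin n → Set ℕ, (∀ i, A i ∈ 𝒜) → (⋂ i, A i).Nonempty

/-- The segment `[α]`: `{1,…,α}` for finite `α`, and all of `ℕ` for `α = ω`. -/
def seg (α : ℕ∞) : Set ℕ :=
  WithTop.recTopCoe Set.univ (fun n => {k | 1 ≤ k ∧ k ≤ n}) α

/-- `O^α_m`: the co-`m`-tons in `[α]`. -/
def Oam (α : ℕ∞) (m : ℕ) : Set (Set ℕ) :=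
  {X | X ⊆ seg α ∧ (seg α \ X).Finite ∧ (seg α \ X).ncard = m}

/-- Characteristic function: `0` on `D`, `1` off `D`. -/
noncomputable def chiD (D : Set ℕ) : ℕ → ℕ := fun n => if n ∈ D then 0 else 1

open Nat.Partrec (Code)

theorem kleene_partrec : Partrec₂ kleene :=
  (Code.eval_part.comp ((Computable.ofNat Code).comp Computable.fst) Computable.snd)

theorem kleene_encode (c : Code) (x : ℕ) : kleene (Encodable.encode c) x = c.eval x := by
  simp [kleene]

/-- Parametrised recursion theorem. -/
theorem exists_rec (G : ℕ × ℕ × ℕ →. ℕ) (hG : Partrec G) :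
    ∃ s : ℕ → ℕ, Computable s ∧ ∀ n y, kleene (s n) y = G (s n, n, y) := by
  have hs : Computable (fun p : Code × ℕ => Encodable.encode (Code.curry p.1 p.2)) :=
    Computable.encode.comp Code.primrec₂_curry.to_comp
  have hF : Partrec₂ (fun (c : Code) (n : ℕ) =>
      G (Encodable.encode (Code.curry c n.unpair.1), n.unpair.1, n.unpair.2)) := by
    have h1 : Computable (fun p : Code × ℕ => p.2.unpair.1) :=
      Computable.fst.comp (Computable.unpair.comp Computable.snd)
    have h2 : Computable (fun p : Code × ℕ => p.2.unpair.2) :=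
      Computable.snd.comp (Computable.unpair.comp Computable.snd)
    exact hG.comp ((hs.comp (Computable.fst.pair h1)).pair (h1.pair h2))
  obtain ⟨c, hc⟩ := Code.fixed_point₂ hF
  refine ⟨fun n => Encodable.encode (Code.curry c n),
    hs.comp ((Computable.const c).pair Computable.id), fun n y => ?_⟩
  rw [kleene_encode, Code.eval_curry, hc]
  simp

theorem exists_smn (F : ℕ × ℕ →. ℕ) (hF : Partrec F) :
    ∃ s : ℕ → ℕ, Computable s ∧ ∀ n y, kleene (s n) y = F (n, y) :=
  exists_rec (fun t => F t.2) (hF.comp Computable.snd)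

theorem part_u : ∃ s : ℕ → ℕ, Computable s ∧ ∀ f : Set ℕ → Set ℕ, ∀ d ∈ Efun f, ∀ p,
    s d ∈ setImp (Lop f p) (L' f p) := by
  obtain ⟨i, -, hi⟩ := exists_smn (fun t => Part.some t.2) Computable.snd
  obtain ⟨j, -, hj⟩ := exists_smn (fun t => Part.some (Nat.pair 0 t.2))
    (Primrec₂.natPair.to_comp.comp (Computable.const 0) Computable.snd)
  obtain ⟨g, hgc, hg⟩ := exists_smn (fun t => (kleene t.1 (i 0)).bind fun k =>
      (kleene k t.2).map fun m => Nat.pair 1 m) (by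
    refine Partrec.bind (kleene_partrec.comp Computable.fst (Computable.const _)) ?_
    refine Partrec.map (kleene_partrec.comp Computable.snd
      (Computable.snd.comp Computable.fst)) ?_
    exact Primrec₂.natPair.to_comp.comp (Computable.const 1) Computable.snd)
  obtain ⟨s, hsc, hs⟩ := exists_smn (fun t => kleene t.2 (Nat.pair (j 0) (g t.1)))
    (kleene_partrec.comp Computable.snd (Primrec₂.natPair.to_comp.comp (Computable.const _)
      (hgc.comp Computable.fst)))
  refine ⟨s, hsc, fun f d hd p z hz => ?_⟩
  rw [hs]
  refine (Set.mem_iInter.1 hz (L' f p)) _ ⟨_, ?_, _, ?_, rfl⟩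
  · intro a ha
    rw [hj]
    exact ⟨_, Part.mem_some _, fun q hq => hq.1 ⟨0, rfl, a, ha, rfl⟩⟩
  · intro x hx
    have key : ∀ q, setAnd {0} p ⊆ q → setAnd {1} (f q) ⊆ q →
        ∃ w ∈ kleene (g d) x, w ∈ q := by
      intro q h0 h1
      have hid : i 0 ∈ setImp (L' f p) q := by
        intro a ha
        rw [hi]
        exact ⟨_, Part.mem_some _, ha q ⟨h0, h1⟩⟩
      obtain ⟨k, hk, hk'⟩ := Set.mem_iInter.1 (Set.mem_iInter.1 hd (L' f p)) q _ hid
      obtain ⟨m, hm, hm'⟩ := hk' x hx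
      refine ⟨Nat.pair 1 m, ?_, h1 ⟨1, rfl, m, hm', rfl⟩⟩
      rw [hg]
      exact Part.mem_bind hk (Part.mem_map _ hm)
    obtain ⟨w, hw, -⟩ := key Set.univ (Set.subset_univ _) (Set.subset_univ _)
    refine ⟨w, hw, fun q hq => ?_⟩
    obtain ⟨w', hw', h⟩ := key q hq.1 hq.2
    rwa [Part.mem_unique hw hw']

theorem part_v : ∃ s : ℕ → ℕ, Computable s ∧ ∀ f : Set ℕ → Set ℕ, ∀ d ∈ Efun f, ∀ p,
    s d ∈ setImp (L' f p) (Lop f p) := by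
  -- parameter `n = ⟨d, ⟨a, b⟩⟩`
  obtain ⟨h, hhc, hh⟩ := exists_rec (fun t =>
      bif t.2.2.unpair.1 == 0 then kleene t.2.1.unpair.2.unpair.1 t.2.2.unpair.2
      else (kleene t.2.1.unpair.1 t.1).bind fun k =>
        (kleene k t.2.2.unpair.2).bind fun m => kleene t.2.1.unpair.2.unpair.2 m) (by
    have hy : Computable (fun t : ℕ × ℕ × ℕ => t.2.2.unpair) :=
      Computable.unpair.comp (Computable.snd.comp Computable.snd)
    have hn : Computable (fun t : ℕ × ℕ × ℕ => t.2.1.unpair) :=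
      Computable.unpair.comp (Computable.fst.comp Computable.snd)
    have hw : Computable (fun t : ℕ × ℕ × ℕ => t.2.1.unpair.2.unpair) :=
      Computable.unpair.comp (Computable.snd.comp hn)
    refine Partrec.cond ?_ ?_ ?_
    · exact Primrec.beq.to_comp.comp (Computable.fst.comp hy) (Computable.const 0)
    · exact kleene_partrec.comp (Computable.fst.comp hw) (Computable.snd.comp hy)
    · refine Partrec.bind (kleene_partrec.comp (Computable.fst.comp hn) Computable.fst) ?_
      refine Partrec.bind (kleene_partrec.comp Computable.snd
        ((Computable.snd.comp hy).comp Computable.fst)) ?_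
      exact kleene_partrec.comp ((Computable.snd.comp hw).comp
        (Computable.fst.comp Computable.fst)) Computable.snd)
  -- `r ⟨d, y⟩` sends `w` to `h ⟨d, w⟩ · y`
  obtain ⟨r, hrc, hr⟩ := exists_smn (fun t =>
      kleene (h (Nat.pair t.1.unpair.1 t.2)) t.1.unpair.2) (by
    have hn : Computable (fun t : ℕ × ℕ => t.1.unpair) :=
      Computable.unpair.comp Computable.fst
    exact kleene_partrec.comp (hhc.comp (Primrec₂.natPair.to_comp.comp
      (Computable.fst.comp hn) Computable.snd)) (Computable.snd.comp hn))
  obtain ⟨s, hsc, hs⟩ := exists_smn (fun t => Part.some (r (Nat.pair t.1 t.2)))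
    (hrc.comp (Primrec₂.natPair.to_comp.comp Computable.fst Computable.snd))
  refine ⟨s, hsc, fun f d hd p y hy => ?_⟩
  rw [hs]
  refine ⟨_, Part.mem_some _, Set.mem_iInter.2 fun q => ?_⟩
  rintro _ ⟨a, ha, b, hb, rfl⟩
  rw [hr]
  simp only [Nat.unpair_pair]
  set e := h (Nat.pair d (Nat.pair a b)) with he
  refine hy {x | ∃ v ∈ kleene e x, v ∈ q} ⟨?_, ?_⟩
  · rintro _ ⟨_, rfl, x, hx, rfl⟩
    have := ha x hx
    simp only [Set.mem_ofPred_eq, he, hh]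
    simpa using this
  · rintro _ ⟨_, rfl, x, hx, rfl⟩
    have hE : e ∈ setImp {x | ∃ v ∈ kleene e x, v ∈ q} q := fun x hx => hx
    obtain ⟨k, hk, hk'⟩ := Set.mem_iInter.1 (Set.mem_iInter.1 hd _) q _ hE
    obtain ⟨m, hm, hm'⟩ := hk' x hx
    obtain ⟨v, hv, hv'⟩ := hb m hm'
    refine ⟨v, ?_, hv'⟩
    rw [he, hh, ← he]
    simp only [Nat.unpair_pair]
    have hc : ((1 : ℕ) == 0) = false := rfl
    rw [hc, cond_false]
    exact Part.mem_bind hk (Part.mem_bind (g := fun m => kleene b m) hm hv)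

/-- Proposition 2.2 (Pitts): `L` and `L'` are isomorphic, uniformly (recursively) in a
realizer `d ∈ E(f)` of monotonicity of `f`. -/
theorem stmt0 :
    ∃ u v : ℕ →. ℕ, Nat.Partrec u ∧ Nat.Partrec v ∧
      ∀ f : Set ℕ → Set ℕ, ∀ d ∈ Efun f,
        (∃ x ∈ u d, x ∈ ⋂ p : Set ℕ, setImp (Lop f p) (L' f p)) ∧
        (∃ x ∈ v d, x ∈ ⋂ p : Set ℕ, setImp (L' f p) (Lop f p)) := by
  obtain ⟨u, hu, hu'⟩ := part_u
  obtain ⟨v, hv, hv'⟩ := part_v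
  refine ⟨fun n => Part.some (u n), fun n => Part.some (v n), Partrec.nat_iff.1 hu,
    Partrec.nat_iff.1 hv, fun f d hd => ⟨?_, ?_⟩⟩
  · exact ⟨_, Part.mem_some _, Set.mem_iInter.2 (hu' f d hd)⟩
  · exact ⟨_, Part.mem_some _, Set.mem_iInter.2 (hv' f d hd)⟩
end

section
/- Let B ⊆ ℕ be nonempty, θ assign to each n ∈ B a nonempty family θ(n) of subsets of ℕ, p ⊆ ℕ and z ∈ ℕ. Then z ∈ L'(G_θ)(p) if and only if there exists a (z,θ,p)-dedicated sight. -/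
open scoped Classical

/-- Proposition 4.4: `z ∈ L'(G_θ)(p)` iff there is a `(z,θ,p)`-dedicated sight. -/
theorem stmt2 (B : Set ℕ) (hB : B.Nonempty) (θ : ℕ → Set (Set ℕ))
    (hθ : ∀ n ∈ B, (θ n).Nonempty) (p : Set ℕ) (z : ℕ) :
    z ∈ L' (Gtheta B θ) p ↔ ∃ S : Sight, Dedicated B θ p z S := by
  constructor
  · intro hz
    refine hz {w | ∃ S : Sight, Dedicated B θ p w S} ⟨?_, ?_⟩
    · rintro x ⟨a, ha, y, hy, rfl⟩
      rw [Set.mem_singleton_iff] at ha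
      subst ha
      exact ⟨Sight.nil, by rw [Dedicated]; exact ⟨y, hy, rfl⟩⟩
    · rintro x ⟨a, ha, y, ⟨n, hn, e, rfl, A, hA, he⟩, rfl⟩
      rw [Set.mem_singleton_iff] at ha
      subst ha
      choose v hv hS using he
      choose S hS using hS
      refine ⟨Sight.node A S, ?_⟩
      rw [Dedicated]
      exact ⟨n, hn, e, rfl, hA, fun a ha => ⟨v a ha, hv a ha, hS a ha⟩⟩
  · rintro ⟨S, hS⟩ q ⟨h0, h1⟩
    induction S generalizing z with
    | nil =>
      rw [Dedicated] at hS
      obtain ⟨y, hy, rfl⟩ := hS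
      exact h0 ⟨0, rfl, y, hy, rfl⟩
    | node A σ ih =>
      rw [Dedicated] at hS
      obtain ⟨n, hn, e, rfl, hA, h⟩ := hS
      refine h1 ⟨1, rfl, _, ⟨n, hn, e, rfl, A, hA, fun a ha => ?_⟩, rfl⟩
      obtain ⟨v, hv, hd⟩ := h a ha
      exact ⟨v, hv, ih a ha v hd⟩
end

section
/- If a degenerate sight is (z,θ,p)-dedicated, then the empty set belongs to ⋃_{n ∈ B} θ(n). -/
open scoped Classical

/-- Proposition 4.7: if a degenerate sight is `(z,θ,p)`-dedicated then
`∅ ∈ ⋃_{n ∈ B} θ(n)`. -/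
theorem stmt3 (B : Set ℕ) (hB : B.Nonempty) (θ : ℕ → Set (Set ℕ))
    (hθ : ∀ n ∈ B, (θ n).Nonempty) (p : Set ℕ) (z : ℕ) (S : Sight)
    (hdeg : Degenerate S) (hded : Dedicated B θ p z S) :
    (∅ : Set ℕ) ∈ ⋃ n ∈ B, θ n := by
  obtain ⟨s, ⟨hs, -⟩, hg⟩ := hdeg
  induction hs generalizing z with
  | nil => exact absurd IsGoodLeaf.nil hg
  | emptyNode A σ hA =>
    rw [Dedicated] at hded
    obtain ⟨n, hn, e, -, hAn, -⟩ := hded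
    subst hA
    exact Set.mem_biUnion hn hAn
  | cons A σ a ha t h ih =>
    rw [Dedicated] at hded
    obtain ⟨n, hn, e, -, -, hv⟩ := hded
    obtain ⟨v, -, hd⟩ := hv a ha
    exact ih v hd (fun h' => hg (IsGoodLeaf.cons A σ a ha t h'))
end

section
/- Let 𝒜 be a nonempty family of subsets of ℕ and f : ℕ → ℕ a function; let ρ_f assign to each n ∈ ℕ the family {{f(n)}}. If there exists a number z such that for every A ∈ 𝒜 there is a (z,ρ_f,A)-dedicated sight (i.e. the basic local operator L(G_𝒜) lies below the least local operator j_f forcing f to be total), then ⋂𝒜 ≠ ∅ (i.e. L(G_𝒜) is the identity local operator). -/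
open scoped Classical

theorem dedicated_common (f : ℕ → ℕ) (A : Set ℕ) (S : Sight) : ∀ z : ℕ,
    Dedicated Set.univ (fun n => {({f n} : Set ℕ)}) A z S →
    ∃ y : ℕ, ∀ (A' : Set ℕ) (S' : Sight),
      Dedicated Set.univ (fun n => {({f n} : Set ℕ)}) A' z S' → y ∈ A' := by
  induction S with
  | nil =>
    rintro z ⟨y, hy, rfl⟩
    refine ⟨y, fun A' S' h' => ?_⟩
    cases S' with
    | nil =>
      obtain ⟨y', hy', he⟩ := h'
      rw [Nat.pair_eq_pair] at he
      rw [he.2]; exact hy'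
    | node B τ =>
      obtain ⟨n, _, e, he, _⟩ := h'
      rw [Nat.pair_eq_pair] at he
      exact absurd he.1 (by norm_num)
  | node B σ ih =>
    rintro z ⟨n, _, e, rfl, hB, hs⟩
    have hB' : B = {f n} := hB
    have hm : f n ∈ B := by rw [hB']; rfl
    obtain ⟨v, hv, hd⟩ := hs (f n) hm
    obtain ⟨y, hy⟩ := ih (f n) hm v hd
    refine ⟨y, fun A' S' h' => ?_⟩
    cases S' with
    | nil =>
      obtain ⟨y', hy', he⟩ := h'
      rw [Nat.pair_eq_pair] at he
      exact absurd he.1 (by norm_num)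
    | node C τ =>
      obtain ⟨n', _, e', he, hC, hs'⟩ := h'
      rw [Nat.pair_eq_pair, Nat.pair_eq_pair] at he
      obtain ⟨_, rfl, rfl⟩ := he
      have hC' : C = {f n} := hC
      have hm' : f n ∈ C := by rw [hC']; rfl
      obtain ⟨v', hv', hd'⟩ := hs' (f n) hm'
      have hvv : v' = v := Part.mem_unique hv' hv
      subst hvv
      exact hy A' _ hd'

/-- Corollary 4.11: if the basic local operator of `𝒜` lies below the least local
operator forcing `f` to be total (witnessed by a uniform `z` with dedicated sights),
then `⋂𝒜 ≠ ∅`, i.e. `L(G_𝒜)` is the identity. -/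
theorem stmt5 (𝒜 : Set (Set ℕ)) (h𝒜 : 𝒜.Nonempty) (f : ℕ → ℕ) (z : ℕ)
    (h : ∀ A ∈ 𝒜, ∃ S : Sight,
      Dedicated Set.univ (fun n => {({f n} : Set ℕ)}) A z S) :
    (⋂₀ 𝒜).Nonempty := by
  obtain ⟨A, hA⟩ := h𝒜
  obtain ⟨S, hS⟩ := h A hA
  obtain ⟨y, hy⟩ := dedicated_common f A S z hS
  refine ⟨y, fun A' hA' => ?_⟩
  obtain ⟨S', hS'⟩ := h A' hA'
  exact hy A' S' hS'
end

section
/- Suppose S and T are sights, d is a coded sequence with d ∈ Tr(S) ∩ Tr(T), and some number z is r-defined on both S and T. If d is a good leaf of S, then d is also a good leaf of T. -/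
open scoped Classical

theorem stmt7_aux (B B' : Set ℕ) (θ θ' : ℕ → Set (Set ℕ)) (S : Sight) (d : List ℕ)
    (hgood : IsGoodLeaf S d) : ∀ (T : Sight) (z : ℕ), InTr T d →
    Dedicated B θ Set.univ z S → Dedicated B' θ' Set.univ z T → IsGoodLeaf T d := by
  induction hgood with
  | nil =>
    intro T z hT hS hD
    cases hT with
    | nil => exact IsGoodLeaf.nil
    | emptyNode A σ hA =>
      simp only [Dedicated] at hS hD
      obtain ⟨y, -, hy⟩ := hS
      obtain ⟨n, -, e, he, -⟩ := hD
      rw [hy, Nat.pair_eq_pair] at he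
      exact absurd he.1 (by decide)
  | cons A σ a ha t h ih =>
    intro T z hT hS hD
    cases hT with
    | cons A' σ' _ ha' _ h' =>
      simp only [Dedicated] at hS hD
      obtain ⟨n, -, e, he, -, hS⟩ := hS
      obtain ⟨n', -, e', he', -, hD⟩ := hD
      rw [he, Nat.pair_eq_pair, Nat.pair_eq_pair] at he'
      obtain ⟨-, -, rfl⟩ := he'
      obtain ⟨v, hv, hS⟩ := hS a ha
      obtain ⟨v', hv', hD⟩ := hD a ha'
      obtain rfl := Part.mem_unique hv hv'
      exact IsGoodLeaf.cons A' σ' a ha' t (ih _ _ h' hS hD)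

/-- Proposition 4.16: if `z` is r-defined on both `S` and `T`, `d ∈ Tr(S) ∩ Tr(T)`
and `d` is a good leaf of `S`, then `d` is a good leaf of `T`. -/
theorem stmt7 (S T : Sight) (d : List ℕ) (hdS : InTr S d) (hdT : InTr T d)
    (z : ℕ) (hzS : RDefined z S) (hzT : RDefined z T)
    (hgood : IsGoodLeaf S d) : IsGoodLeaf T d := by
  obtain ⟨B, θ, -, -, hS⟩ := hzS
  obtain ⟨B', θ', -, -, hT⟩ := hzT
  exact stmt7_aux B B' θ θ' S d hgood T z hdT hS hT
end

section
/- Let 𝒜 and ℬ be nonempty families of subsets of ℕ and n ≥ 1, such that ℬ has the n-intersection property while 𝒜 contains sets A₁,…,Aₙ with A₁ ∩ ⋯ ∩ Aₙ = ∅. Then ¬(𝒜 ≤_L ℬ). -/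
open scoped Classical

theorem setImp_mono' (A : Set ℕ) {p q : Set ℕ} (h : p ⊆ q) : setImp A p ⊆ setImp A q := by
  intro e he a ha
  obtain ⟨v, hv, hp⟩ := he a ha
  exact ⟨v, hv, h hp⟩

theorem L'_inv (ℬ : Set (Set ℕ)) (p : Set ℕ) (z : ℕ) (hz : z ∈ L' (GA ℬ) p) :
    (∃ y ∈ p, z = Nat.pair 0 y) ∨
      ∃ B ∈ ℬ, ∃ e ∈ setImp B (L' (GA ℬ) p), z = Nat.pair 1 e := by
  have hcl : setAnd {1} (GA ℬ (L' (GA ℬ) p)) ⊆ L' (GA ℬ) p := by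
    rintro _ ⟨a, ha, e, he, rfl⟩ q hq
    refine hq.2 ⟨a, ha, e, ?_, rfl⟩
    simp only [GA, Set.mem_iUnion] at he ⊢
    obtain ⟨B, hB, he⟩ := he
    exact ⟨B, hB, setImp_mono' B (Set.sInter_subset_of_mem hq) he⟩
  have h0 : setAnd {0} p ⊆ L' (GA ℬ) p := fun x hx q hq => hq.1 hx
  refine hz {z | (∃ y ∈ p, z = Nat.pair 0 y) ∨
      ∃ B ∈ ℬ, ∃ e ∈ setImp B (L' (GA ℬ) p), z = Nat.pair 1 e} ⟨?_, ?_⟩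
  · rintro _ ⟨a, ha, y, hy, rfl⟩
    rw [Set.mem_singleton_iff] at ha
    subst ha
    exact Or.inl ⟨y, hy, rfl⟩
  · rintro _ ⟨a, ha, e, he, rfl⟩
    rw [Set.mem_singleton_iff] at ha
    subst ha
    simp only [GA, Set.mem_iUnion] at he
    obtain ⟨B, hB, he⟩ := he
    refine Or.inr ⟨B, hB, e, setImp_mono' B ?_ he, rfl⟩
    rintro x (⟨y, hy, rfl⟩ | ⟨C, hC, f, hf, rfl⟩)
    · exact h0 ⟨0, rfl, y, hy, rfl⟩
    · refine hcl ⟨1, rfl, f, ?_, rfl⟩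
      simp only [GA, Set.mem_iUnion]
      exact ⟨C, hC, hf⟩

/-- Proposition 4.17: if `ℬ` has the `n`-intersection property while `𝒜` contains
`n` sets with empty intersection, then `¬(𝒜 ≤_L ℬ)`. -/
theorem stmt8 (𝒜 ℬ : Set (Set ℕ)) (h𝒜 : 𝒜.Nonempty) (hℬ : ℬ.Nonempty)
    (n : ℕ) (hn : 1 ≤ n) (hB : nIntProp ℬ n)
    (hA : ∃ A : Fin n → Set ℕ, (∀ i, A i ∈ 𝒜) ∧ ⋂ i, A i = ∅) :
    ¬ leL 𝒜 ℬ := by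
  rintro ⟨z, hz⟩
  obtain ⟨A, hA𝒜, hAe⟩ := hA
  let i0 : Fin n := ⟨0, hn⟩
  have key : z ∈ {z | (∀ i, i ≠ i0 → z ∈ L' (GA ℬ) (A i)) → ∃ y, ∀ i, y ∈ A i} := by
    refine hz (A i0) (hA𝒜 i0) _ ⟨?_, ?_⟩
    · rintro _ ⟨a, ha, y, hy, rfl⟩ H
      rw [Set.mem_singleton_iff] at ha
      subst ha
      refine ⟨y, fun i => ?_⟩
      by_cases hi : i = i0
      · rw [hi]; exact hy
      · rcases L'_inv _ _ _ (H i hi) with ⟨y', hy', h⟩ | ⟨B, _, e, _, h⟩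
        · rw [Nat.pair_eq_pair] at h
          rw [h.2]; exact hy'
        · rw [Nat.pair_eq_pair] at h
          exact absurd h.1 (by decide)
    · rintro _ ⟨a, ha, e, he, rfl⟩ H
      rw [Set.mem_singleton_iff] at ha
      subst ha
      simp only [GA, Set.mem_iUnion] at he
      obtain ⟨B0, hB0, he⟩ := he
      have H2 : ∀ i, ∃ B ∈ ℬ, (i = i0 → B = B0) ∧
          (i ≠ i0 → e ∈ setImp B (L' (GA ℬ) (A i))) := by
        intro i
        by_cases hi : i = i0
        · exact ⟨B0, hB0, fun _ => rfl, fun h => absurd hi h⟩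
        · rcases L'_inv _ _ _ (H i hi) with ⟨y', hy', h⟩ | ⟨B, hBm, e', he', h⟩
          · rw [Nat.pair_eq_pair] at h
            exact absurd h.1 (by decide)
          · rw [Nat.pair_eq_pair] at h
            rw [← h.2] at he'
            exact ⟨B, hBm, fun h => absurd h hi, fun _ => he'⟩
      choose B hBm hB1 hB2 using H2
      obtain ⟨a, ha⟩ := hB B hBm
      rw [Set.mem_iInter] at ha
      obtain ⟨v, hv, hq⟩ := he a (hB1 i0 rfl ▸ ha i0)
      refine hq fun i hi => ?_
      obtain ⟨w, hw, hL⟩ := hB2 i hi a (ha i)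
      rw [Part.mem_unique hv hw]
      exact hL
  obtain ⟨y, hy⟩ := key fun i _ => hz _ (hA𝒜 i)
  have : y ∈ ⋂ i, A i := Set.mem_iInter.2 hy
  rw [hAe] at this
  exact this
end

section
/- Let 1 < 2m < α ≤ ω. Then O^α_m < O^α_{m+1} in the preorder of families: there exists k ∈ ℕ (any index of the identity function works) such that for every A ∈ O^α_m there is B ∈ O^α_{m+1} with k ∈ (B → A); but there is no k ∈ ℕ such that for every A ∈ O^α_{m+1} there is B ∈ O^α_m with k ∈ (B → A). -/
open scoped Classical

theorem aux_seg (n : ℕ) (α : ℕ∞) (h : (n : ℕ) < α) :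
    ((n + 1 : ℕ) : ℕ∞) ≤ (seg α).encard := by
  induction α using WithTop.recTopCoe with
  | top =>
    have : seg (⊤ : ℕ∞) = Set.univ := rfl
    have h' : seg ⊤ = Set.univ := rfl
    erw [h']
    rw [Set.encard_univ]
    simp
  | coe a =>
    have h' : seg (a : ℕ∞) = ((Finset.Icc 1 a : Finset ℕ) : Set ℕ) := by
      ext x
      simp only [Finset.coe_Icc, Set.mem_Icc]
      rfl
    erw [h']
    rw [Set.encard_coe_eq_coe_finsetCard]
    have : n < a := ENat.coe_lt_coe.1 h
    simp only [Nat.card_Icc]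
    exact_mod_cast (by omega : n + 1 ≤ a + 1 - 1)

theorem aux_compl (α : ℕ∞) (C : Set ℕ) (n : ℕ) (hC : C ⊆ seg α) (hn : C.encard = n) :
    seg α \ C ∈ Oam α n := by
  have h : seg α \ (seg α \ C) = C := by
    rw [Set.diff_diff_cancel_left hC]
  refine ⟨Set.diff_subset, ?_, ?_⟩
  · rw [h]; exact Set.finite_of_encard_eq_coe hn
  · rw [h, Set.ncard, hn]; rfl

theorem aux_card {α : ℕ∞} {n : ℕ} {A : Set ℕ} (h : A ∈ Oam α n) : (seg α \ A).encard = n := by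
  obtain ⟨_, h2, h3⟩ := h
  rw [← h2.cast_ncard_eq, h3]

theorem aux_split {α : ℕ∞} {n k : ℕ} {A : Set ℕ} (h : A ∈ Oam α n)
    (hk : ((k + n : ℕ) : ℕ∞) ≤ (seg α).encard) : (k : ℕ∞) ≤ A.encard := by
  have := Set.encard_diff_add_encard_of_subset h.1
  rw [aux_card h] at this
  rw [← this] at hk
  push_cast at hk
  rw [add_comm (n : ℕ∞)] at hk
  exact (ENat.add_le_add_iff_right (ENat.coe_ne_top n)).1 hk

/-- Proposition 5.1: for `1 < 2m < α ≤ ω`, `O^α_m < O^α_{m+1}` in the preorder `M*`. -/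
theorem stmt10 (m : ℕ) (α : ℕ∞) (h1 : 1 < 2 * m) (h2 : (2 * m : ℕ) < α) :
    (∃ k : ℕ, ∀ A ∈ Oam α m, ∃ B ∈ Oam α (m + 1), k ∈ setImp B A) ∧
    ¬ (∃ k : ℕ, ∀ A ∈ Oam α (m + 1), ∃ B ∈ Oam α m, k ∈ setImp B A) := by
  have hS := aux_seg _ _ h2
  have hle : ∀ j : ℕ, j ≤ 2 * m + 1 → (j : ℕ∞) ≤ (seg α).encard := fun j hj =>
    le_trans (by exact_mod_cast hj) hS
  constructor
  · refine ⟨Encodable.encode Nat.Partrec.Code.id, fun A hA => ?_⟩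
    have h0 : ((1 : ℕ) : ℕ∞) ≤ A.encard := aux_split hA (hle _ (by omega))
    have hne : A.Nonempty := by
      rw [← Set.one_le_encard_iff_nonempty]; simpa using h0
    obtain ⟨a, ha⟩ := hne
    have hc : (insert a (seg α \ A)).encard = ((m + 1 : ℕ) : ℕ∞) := by
      rw [Set.encard_insert_of_notMem (fun h => h.2 ha), aux_card hA]; simp
    refine ⟨_, aux_compl α _ _ (Set.insert_subset (hA.1 ha) Set.diff_subset) hc, ?_⟩
    intro x hx
    refine ⟨x, ?_, ?_⟩
    · simp [kleene, Denumerable.ofNat_encode, Nat.Partrec.Code.eval_id]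
    · by_contra hxA
      exact hx.2 (Or.inr ⟨hx.1, hxA⟩)
  · rintro ⟨k, hk⟩
    obtain ⟨C0, hC0, hC0c⟩ := Set.exists_subset_encard_eq (hle (m + 1) (by omega))
    obtain ⟨B0, hB0, hkB⟩ := hk _ (aux_compl α C0 (m + 1) hC0 hC0c)
    obtain ⟨E, hE, hEc⟩ := Set.exists_subset_encard_eq
      (aux_split (k := m + 1) hB0 (hle _ (by omega)))
    choose! v hv hvA using hkB
    have hI : (v '' E).encard ≤ ((m + 1 : ℕ) : ℕ∞) := hEc ▸ Set.encard_image_le v E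
    have hIS : v '' E ⊆ seg α := by
      rintro _ ⟨e, he, rfl⟩
      exact (hvA e (hE he)).1
    obtain ⟨C, hIC, hCS, hCc⟩ := Set.exists_superset_subset_encard_eq hIS hI
      (hle (m + 1) (by omega))
    obtain ⟨B, hB, hkB'⟩ := hk _ (aux_compl α C (m + 1) hCS hCc)
    have hnot : ¬ E ⊆ seg α \ B := by
      intro h
      have := Set.encard_le_encard h
      rw [hEc, aux_card hB] at this
      have : m + 1 ≤ m := by exact_mod_cast this
      omega
    rw [Set.not_subset] at hnot
    obtain ⟨e, he, heB⟩ := hnot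
    have heB' : e ∈ B := by
      by_contra h
      exact heB ⟨hB0.1 (hE he), h⟩
    obtain ⟨w, hw, hwA⟩ := hkB' e heB'
    have : w = v e := Part.mem_unique hw (hv e (hE he))
    subst this
    exact hwA.2 (hIC ⟨e, he, rfl⟩)
end

section
/- Let 1 ≤ m < ω. Then O^ω_1 ≅_L O^ω_m, i.e. both O^ω_1 ≤_L O^ω_m and O^ω_m ≤_L O^ω_1 hold. -/
open scoped Classical

lemma aux_seg_top : seg ⊤ = Set.univ := rfl

lemma aux_L'_ret (f : Set ℕ → Set ℕ) (A : Set ℕ) (a : ℕ) (ha : a ∈ A) :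
    Nat.pair 0 a ∈ L' f A := by
  rintro q ⟨h0, -⟩
  exact h0 ⟨0, rfl, a, ha, rfl⟩

lemma aux_L'_step (𝒜 : Set (Set ℕ)) (A B : Set ℕ) (hB : B ∈ 𝒜) (e : ℕ)
    (he : e ∈ setImp B (L' (GA 𝒜) A)) : Nat.pair 1 e ∈ L' (GA 𝒜) A := by
  rintro q ⟨h0, h1⟩
  refine h1 ⟨1, rfl, e, ?_, rfl⟩
  refine Set.mem_biUnion hB ?_
  intro a ha
  obtain ⟨v, hv, hv'⟩ := he a ha
  exact ⟨v, hv, hv' q ⟨h0, h1⟩⟩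

/-- s-m-n for total computable functions. -/
lemma aux_smn (g : ℕ → ℕ) (hg : Computable g) :
    ∃ c : ℕ → ℕ, Computable c ∧ ∀ s x, g (Nat.pair s x) ∈ kleene (c s) x := by
  obtain ⟨d, hd⟩ := Nat.Partrec.Code.exists_code.1 (Partrec.nat_iff.1 hg.partrec)
  refine ⟨fun s => Encodable.encode (Nat.Partrec.Code.curry d s), ?_, ?_⟩
  · exact Computable.encode.comp
      (Nat.Partrec.Code.primrec₂_curry.to_comp.comp (Computable.const d) Computable.id)
  · intro s x
    simp [kleene, Nat.Partrec.Code.eval_curry, hd]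

lemma aux_main (m : ℕ) : ∀ h : ℕ → ℕ, Computable h → ∃ g : ℕ → ℕ, Computable g ∧
    ∀ (s : ℕ) (A : Set ℕ), {y | h (Nat.pair s y) ∉ A}.encard ≤ m →
      g s ∈ L' (GA (Oam ⊤ 1)) A := by
  induction m with
  | zero =>
    intro h hh
    refine ⟨fun s => Nat.pair 0 (h (Nat.pair s 0)), ?_, ?_⟩
    · exact Primrec₂.natPair.to_comp.comp (Computable.const 0)
        (hh.comp (Primrec₂.natPair.to_comp.comp Computable.id (Computable.const 0)))
    · intro s A hA
      apply aux_L'_ret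
      by_contra hc
      have h0 : {y | h (Nat.pair s y) ∉ A} = ∅ := by simpa using hA
      have : (0 : ℕ) ∈ {y | h (Nat.pair s y) ∉ A} := hc
      rw [h0] at this
      exact this
  | succ m ih =>
    intro h hh
    obtain ⟨g, hg, H⟩ := ih (fun z => h (Nat.pair z.unpair.1.unpair.1
      (Nat.pair z.unpair.1.unpair.2 z.unpair.2))) (by
        have u1 : Computable (fun z : ℕ => z.unpair.1) :=
          Computable.fst.comp Computable.unpair
        have u2 : Computable (fun z : ℕ => z.unpair.2) :=
          Computable.snd.comp Computable.unpair
        exact hh.comp (Primrec₂.natPair.to_comp.comp (u1.comp u1)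
          (Primrec₂.natPair.to_comp.comp (u2.comp u1) u2)))
    obtain ⟨c, hc, hc'⟩ := aux_smn g hg
    refine ⟨fun s => Nat.pair 1 (c s),
      Primrec₂.natPair.to_comp.comp (Computable.const 1) hc, ?_⟩
    intro s A hA
    obtain ⟨p, hp⟩ : ∃ p : ℕ, ∀ x ≠ p, 
        {y | h (Nat.pair s (Nat.pair x y)) ∉ A}.encard ≤ m := by
      set F := {y | h (Nat.pair s y) ∉ A} with hF
      have key : ∀ x y0, x ≠ (Nat.unpair y0).1 →
          {y | h (Nat.pair s (Nat.pair x y)) ∉ A}.encard ≤ (F \ {y0}).encard := by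
        intro x y0 hx
        have hinj : Function.Injective (Nat.pair x) := by
          intro a b hab
          exact (Nat.pair_eq_pair.1 hab).2
        rw [← hinj.encard_image]
        apply Set.encard_le_encard
        rintro _ ⟨y, hy, rfl⟩
        refine ⟨hy, ?_⟩
        rintro hy0
        apply hx
        rw [← Set.mem_singleton_iff.1 hy0]; simp
      rcases Set.eq_empty_or_nonempty F with hE | ⟨y0, hy0⟩
      · refine ⟨(Nat.unpair 0).1, fun x hx => (key x 0 hx).trans ?_⟩
        simp [hE]
      · refine ⟨(Nat.unpair y0).1, fun x hx => (key x y0 hx).trans ?_⟩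
        have := Set.encard_diff_singleton_add_one hy0
        rw [← this] at hA
        push_cast at hA
        exact (ENat.add_le_add_iff_right (by simp)).1 hA
    refine aux_L'_step _ _ {p}ᶜ ?_ _ ?_
    · simp [Oam, aux_seg_top, ← Set.compl_eq_univ_diff]
    · intro x hx
      refine ⟨_, hc' s x, H _ _ ?_⟩
      simpa using hp x hx

/-- Proposition 5.2: for `1 ≤ m < ω`, `O^ω_1 ≅_L O^ω_m`. -/
theorem stmt11 (m : ℕ) (hm : 1 ≤ m) :
    leL (Oam ⊤ 1) (Oam ⊤ m) ∧ leL (Oam ⊤ m) (Oam ⊤ 1) := by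
  constructor
  · obtain ⟨c, -, hc⟩ := aux_smn (fun z => Nat.pair 0 z.unpair.2)
      (Primrec₂.natPair.to_comp.comp (Computable.const 0)
        (Computable.snd.comp Computable.unpair))
    refine ⟨Nat.pair 1 (c 0), ?_⟩
    rintro A ⟨-, -, hA⟩
    rw [aux_seg_top, ← Set.compl_eq_univ_diff] at hA
    obtain ⟨a, ha⟩ := Set.ncard_eq_one.1 hA
    refine aux_L'_step _ _ (Set.Ico a (a + m))ᶜ ?_ _ ?_
    · refine ⟨fun _ _ => trivial, ?_, ?_⟩
      · rw [aux_seg_top, ← Set.compl_eq_univ_diff, compl_compl]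
        exact Set.finite_Ico _ _
      · rw [aux_seg_top, ← Set.compl_eq_univ_diff, compl_compl,
          ← Finset.coe_Ico, Set.ncard_coe_finset]
        simp
    · intro x hx
      refine ⟨_, hc 0 x, ?_⟩
      apply aux_L'_ret
      by_contra hxA
      have : x ∈ Aᶜ := by simpa using hxA
      rw [ha] at this
      apply hx
      rw [Set.mem_singleton_iff.1 this]
      simp; omega
  · obtain ⟨g, -, hg⟩ := aux_main m (fun z => z.unpair.2)
      (Computable.snd.comp Computable.unpair)
    refine ⟨g 0, ?_⟩
    rintro A ⟨-, hfin, hA⟩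
    apply hg
    rw [aux_seg_top, ← Set.compl_eq_univ_diff] at hA hfin
    have : {y | (Nat.unpair (Nat.pair 0 y)).2 ∉ A} = Aᶜ := by ext; simp
    rw [this, ← hfin.cast_ncard_eq, hA]
end

section
/- Let 1 ≤ m < α < ω. Then ⌈α/m⌉, the least integer ≥ α/m, is the least number d such that there exist d elements A₁,…,A_d of O^α_m with A₁ ∩ ⋯ ∩ A_d = ∅. -/
open scoped Classical

/-- Proposition 5.3: `⌈α/m⌉` is the least `d` such that some `d` members of `O^α_m`
have empty intersection. (In `ℕ`, `⌈α/m⌉ = (α + m - 1) / m`.) -/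
theorem stmt12 (m α : ℕ) (hm : 1 ≤ m) (hmα : m < α) :
    IsLeast {d : ℕ | ∃ A : Fin d → Set ℕ, (∀ i, A i ∈ Oam (α : ℕ∞) m) ∧ ⋂ i, A i = ∅}
      ((α + m - 1) / m) := by
  have hseg : seg (α : ℕ∞) = ↑(Finset.Icc 1 α) := by
    ext k
    rw [Finset.coe_Icc]
    exact Iff.rfl
  constructor
  · refine ⟨fun i => ↑(Finset.Icc 1 α) \
      ↑(Finset.Icc (min (i.1 * m) (α - m) + 1) (min (i.1 * m) (α - m) + m)), ?_, ?_⟩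
    · intro i
      have hsub : Finset.Icc (min (i.1 * m) (α - m) + 1) (min (i.1 * m) (α - m) + m)
          ⊆ Finset.Icc 1 α := by
        intro k hk
        rw [Finset.mem_Icc] at *
        omega
      have heq : seg (α : ℕ∞) \ (↑(Finset.Icc 1 α) \
          ↑(Finset.Icc (min (i.1 * m) (α - m) + 1) (min (i.1 * m) (α - m) + m)))
          = ↑(Finset.Icc (min (i.1 * m) (α - m) + 1) (min (i.1 * m) (α - m) + m)) := by
        rw [hseg]
        exact Set.diff_diff_cancel_left (Finset.coe_subset.2 hsub)
      refine ⟨?_, ?_, ?_⟩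
      · rw [hseg]
        exact Set.diff_subset
      · rw [heq]
        exact Finset.finite_toSet _
      · rw [heq, Set.ncard_coe_finset, Nat.card_Icc]
        omega
    · rw [Set.eq_empty_iff_forall_notMem]
      intro x hx
      rw [Set.mem_iInter] at hx
      have hpos : 0 < (α + m - 1) / m := Nat.div_pos (by omega) hm
      have h0 := (hx ⟨0, hpos⟩).1
      rw [Finset.mem_coe, Finset.mem_Icc] at h0
      have hlt : (x - 1) / m < (α + m - 1) / m := by
        rw [Nat.lt_iff_add_one_le, ← Nat.add_div_right _ hm]
        exact Nat.div_le_div_right (by omega)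
      have h1 := (hx ⟨(x - 1) / m, hlt⟩).2
      apply h1
      rw [Finset.mem_coe, Finset.mem_Icc]
      have h2 := Nat.div_add_mod (x - 1) m
      have h3 := Nat.mod_lt (x - 1) hm
      rw [mul_comm] at h2
      dsimp only
      generalize (x - 1) / m * m = q at *
      omega
  · rintro d ⟨A, hA, hI⟩
    have hcov : (↑(Finset.Icc 1 α) : Set ℕ) ⊆ ⋃ i, (seg (α : ℕ∞) \ A i) := by
      intro x hx
      by_contra hn
      have : x ∈ ⋂ i, A i := by
        rw [Set.mem_iInter]
        intro i
        by_contra hxi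
        exact hn (Set.mem_iUnion.2 ⟨i, by rw [hseg]; exact hx, hxi⟩)
      rw [hI] at this
      exact this
    have hfin : (⋃ i, (seg (α : ℕ∞) \ A i)).Finite :=
      Set.finite_iUnion fun i => (hA i).2.1
    have h1 := Set.ncard_le_ncard hcov hfin
    rw [Set.ncard_coe_finset, Nat.card_Icc] at h1
    have h2 : (⋃ i, (seg (α : ℕ∞) \ A i)).ncard ≤ ∑ i, (seg (α : ℕ∞) \ A i).ncard :=
      Set.ncard_iUnion_le_of_fintype _
    rw [Finset.sum_congr rfl (fun i _ => (hA i).2.2)] at h2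
    simp only [Finset.sum_const, Finset.card_univ, Fintype.card_fin, smul_eq_mul] at h2
    rw [← Nat.lt_add_one_iff, Nat.div_lt_iff_lt_mul hm, add_mul]
    omega
end

section
/- Let 1 < 2m < α < ω and suppose ⌈α/(m+1)⌉ < ⌈α/m⌉. Then ¬(O^α_{m+1} ≤_L O^α_m); since also O^α_m ≤_L O^α_{m+1}, this means O^α_m <_L O^α_{m+1}. -/
open scoped Classical

theorem seg_coe' (n : ℕ) : seg (n : ℕ∞) = ((Finset.Icc 1 n : Finset ℕ) : Set ℕ) := by
  ext x; simp; rfl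

theorem GA_mono' (𝒜 : Set (Set ℕ)) {p q : Set ℕ} (h : p ⊆ q) : GA 𝒜 p ⊆ GA 𝒜 q := by
  intro e he
  simp only [GA, Set.mem_iUnion] at he ⊢
  obtain ⟨A, hA, he⟩ := he
  refine ⟨A, hA, fun a ha => ?_⟩
  obtain ⟨v, hv, hp⟩ := he a ha
  exact ⟨v, hv, h hp⟩

theorem L'_closed (𝒜 : Set (Set ℕ)) (p : Set ℕ) :
    setAnd {0} p ⊆ L' (GA 𝒜) p ∧ setAnd {1} (GA 𝒜 (L' (GA 𝒜) p)) ⊆ L' (GA 𝒜) p := by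
  constructor
  · intro z hz q hq
    exact hq.1 hz
  · rintro z ⟨a, ha, b, hb, rfl⟩ q hq
    exact hq.2 ⟨a, ha, b, GA_mono' 𝒜 (Set.sInter_subset_of_mem hq) hb, rfl⟩

theorem L'_inv_s13 (𝒜 : Set (Set ℕ)) (p : Set ℕ) (z : ℕ) (hz : z ∈ L' (GA 𝒜) p) :
    z ∈ setAnd {0} p ∨ z ∈ setAnd {1} (GA 𝒜 (L' (GA 𝒜) p)) := by
  have hc := L'_closed 𝒜 p
  refine hz (setAnd {0} p ∪ setAnd {1} (GA 𝒜 (L' (GA 𝒜) p))) ⟨fun x hx => Or.inl hx, ?_⟩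
  rintro z ⟨a, ha, b, hb, rfl⟩
  exact Or.inr ⟨a, ha, b, GA_mono' 𝒜 (Set.union_subset hc.1 hc.2) hb, rfl⟩

theorem nInt_transfer (ℬ : Set (Set ℕ)) (n : ℕ) (hB : nIntProp ℬ n) (i0 : Fin n)
    (A : Fin n → Set ℕ) (z : ℕ) (hz : ∀ i, z ∈ L' (GA ℬ) (A i)) : (⋂ i, A i).Nonempty := by
  have key : z ∈ {z | (∀ i, i ≠ i0 → z ∈ L' (GA ℬ) (A i)) → (⋂ i, A i).Nonempty} := by
    refine hz i0 _ ⟨?_, ?_⟩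
    · rintro z ⟨a, ha, y, hy, rfl⟩ h
      rw [Set.mem_singleton_iff] at ha
      subst ha
      refine ⟨y, Set.mem_iInter.2 fun i => ?_⟩
      by_cases hi : i = i0
      · rw [hi]; exact hy
      rcases L'_inv_s13 _ _ _ (h i hi) with ⟨a, ha, b, hb, e⟩ | ⟨a, ha, b, hb, e⟩
      · rw [Nat.pair_eq_pair] at e; rw [e.2]; exact hb
      · rw [Nat.pair_eq_pair] at e; rw [← e.1] at ha; simp at ha
    · rintro z ⟨a, ha, e, he, rfl⟩ h
      rw [Set.mem_singleton_iff] at ha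
      subst ha
      simp only [GA, Set.mem_iUnion] at he
      obtain ⟨B0, hB0, he⟩ := he
      have h' : ∀ i, ∃ B ∈ ℬ, (i = i0 → B = B0) ∧
          (i ≠ i0 → e ∈ setImp B (L' (GA ℬ) (A i))) := by
        intro i
        by_cases hi : i = i0
        · exact ⟨B0, hB0, fun _ => rfl, fun h => absurd hi h⟩
        rcases L'_inv_s13 _ _ _ (h i hi) with ⟨a, ha, b, hb, e'⟩ | ⟨a, ha, b, hb, e'⟩
        · rw [Nat.pair_eq_pair] at e'; rw [← e'.1] at ha; simp at ha
        · rw [Nat.pair_eq_pair] at e'; rw [← e'.2] at hb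
          simp only [GA, Set.mem_iUnion] at hb
          obtain ⟨B, hB, hb⟩ := hb
          exact ⟨B, hB, fun h => absurd h hi, fun _ => hb⟩
      choose B hBm hB1 hB2 using h'
      obtain ⟨b, hb⟩ := hB B hBm
      rw [Set.mem_iInter] at hb
      obtain ⟨v, hv, hvq⟩ := he b (hB1 i0 rfl ▸ hb i0)
      refine hvq fun i hi => ?_
      obtain ⟨w, hw, hwL⟩ := hB2 i hi b (hb i)
      rw [Part.mem_unique hv hw]; exact hwL
  exact key fun i _ => hz i

theorem Oam_nInt (m α n : ℕ) (h : n * m < α) : nIntProp (Oam (α : ℕ∞) m) n := by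
  intro A hA
  by_contra hne
  have hsub : seg (α : ℕ∞) ⊆ ⋃ i, (seg (α : ℕ∞) \ A i) := by
    intro x hx
    by_contra hx'
    apply hne
    refine ⟨x, Set.mem_iInter.2 fun i => ?_⟩
    by_contra hi
    exact hx' (Set.mem_iUnion.2 ⟨i, hx, hi⟩)
  have h1 : (seg (α : ℕ∞)).ncard = α := by
    rw [seg_coe', Set.ncard_coe_finset]; simp
  have h2 := Set.ncard_le_ncard hsub (Set.finite_iUnion fun i => (hA i).2.1)
  have h3 : (⋃ i, (seg (α : ℕ∞) \ A i)).ncard ≤ ∑ i, (seg (α : ℕ∞) \ A i).ncard :=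
    Set.ncard_iUnion_le_of_fintype _
  rw [Finset.sum_congr rfl fun i _ => (hA i).2.2] at h3
  simp at h3
  omega

theorem Oam_cover (k α n : ℕ) (hk : 0 < k) (hkα : k ≤ α) (h : α ≤ n * k) :
    ¬ nIntProp (Oam (α : ℕ∞) k) n ∧ ∃ A : Fin n → Set ℕ, (∀ i, A i ∈ Oam (α : ℕ∞) k) ∧
      ¬ (⋂ i, A i).Nonempty := by
  have : ∃ A : Fin n → Set ℕ, (∀ i, A i ∈ Oam (α : ℕ∞) k) ∧
      ¬ (⋂ i, A i).Nonempty := by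
    let s : Fin n → ℕ := fun i => min (i * k) (α - k)
    refine ⟨fun i => seg (α : ℕ∞) \ (Finset.Ioc (s i) (s i + k) : Finset ℕ), fun i => ?_, ?_⟩
    · have hs : s i ≤ α - k := min_le_right _ _
      have : seg (α : ℕ∞) \ (seg (α : ℕ∞) \ (Finset.Ioc (s i) (s i + k) : Finset ℕ)) =
          ((Finset.Ioc (s i) (s i + k) : Finset ℕ) : Set ℕ) := by
        rw [Set.sdiff_sdiff_cancel_left]
        rw [seg_coe']
        intro x hx
        simp at hx ⊢
        omega
      refine ⟨Set.sdiff_subset, ?_, ?_⟩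
      · rw [this]; exact Finset.finite_toSet _
      · rw [this, Set.ncard_coe_finset]; simp
    · rintro ⟨x, hx⟩
      rw [Set.mem_iInter] at hx
      have hn : 0 < n := by
        rcases Nat.eq_zero_or_pos n with h0 | h0
        · subst h0; omega
        · exact h0
      have hxs := (hx ⟨0, hn⟩).1
      rw [seg_coe'] at hxs
      simp at hxs
      have hlt : (x - 1) / k < n := by
        rw [Nat.div_lt_iff_lt_mul hk]; omega
      have h3 := (hx ⟨(x - 1) / k, hlt⟩).2
      apply h3
      have h4 := Nat.div_add_mod (x - 1) k
      have h5 := Nat.mod_lt (x - 1) hk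
      rw [mul_comm] at h4
      simp only [s, Finset.coe_Ioc, Set.mem_Ioc]
      generalize (x - 1) / k * k = t at *
      omega
  refine ⟨?_, this⟩
  obtain ⟨A, hA, hn⟩ := this
  exact fun hh => hn (hh A hA)

theorem Oam_le_succ (m α : ℕ) (h : m < α) :
    leL (Oam (α : ℕ∞) m) (Oam (α : ℕ∞) (m + 1)) := by
  let c : Nat.Partrec.Code := Nat.Partrec.Code.pair Nat.Partrec.Code.zero Nat.Partrec.Code.id
  have hc : ∀ a, Nat.pair 0 a ∈ kleene (Encodable.encode c) a := by
    intro a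
    simp only [kleene, Denumerable.ofNat_encode, c, Nat.Partrec.Code.eval,
      Nat.Partrec.Code.eval_id]
    simp [Seq.seq]
    exact Part.mem_some 0
  refine ⟨Nat.pair 1 (Encodable.encode c), fun A hA => ?_⟩
  have hcl := L'_closed (Oam (α : ℕ∞) (m + 1)) A
  refine hcl.2 ⟨1, rfl, _, ?_, rfl⟩
  have hA0 : A.Nonempty := by
    by_contra hne
    rw [Set.not_nonempty_iff_eq_empty] at hne
    subst hne
    have := hA.2.2
    rw [seg_coe', Set.sdiff_empty, Set.ncard_coe_finset] at this
    simp at this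
    omega
  obtain ⟨x, hx⟩ := hA0
  simp only [GA, Set.mem_iUnion]
  have heq : seg (α : ℕ∞) \ (A \ {x}) = insert x (seg (α : ℕ∞) \ A) := by
    ext y
    have := @hA.1 x hx
    by_cases hy : y = x
    · subst hy; simp [this]
    · simp [hy]
  refine ⟨A \ {x}, ⟨fun y hy => hA.1 hy.1, ?_, ?_⟩, fun a ha => ⟨_, hc a, hcl.1 ⟨0, rfl, a, ha.1, rfl⟩⟩⟩
  · rw [heq]; exact hA.2.1.insert x
  · rw [heq, Set.ncard_insert_of_notMem (fun hh => hh.2 hx) hA.2.1, hA.2.2]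

/-- Proposition 5.4: if `1 < 2m < α < ω` and `⌈α/(m+1)⌉ < ⌈α/m⌉`, then
`¬(O^α_{m+1} ≤_L O^α_m)`, while `O^α_m ≤_L O^α_{m+1}`; so `O^α_m <_L O^α_{m+1}`. -/
theorem stmt13 (m α : ℕ) (h1 : 1 < 2 * m) (h2 : 2 * m < α)
    (hceil : (α + (m + 1) - 1) / (m + 1) < (α + m - 1) / m) :
    ¬ leL (Oam (α : ℕ∞) (m + 1)) (Oam (α : ℕ∞) m) ∧
      leL (Oam (α : ℕ∞) m) (Oam (α : ℕ∞) (m + 1)) := by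
  refine ⟨?_, Oam_le_succ m α (by omega)⟩
  rintro ⟨z, hz⟩
  have hlow : α ≤ (α + (m + 1) - 1) / (m + 1) * (m + 1) := by
    have h4 := Nat.div_add_mod (α + (m + 1) - 1) (m + 1)
    have h5 := Nat.mod_lt (α + (m + 1) - 1) (show 0 < m + 1 by omega)
    rw [mul_comm] at h4
    generalize (α + (m + 1) - 1) / (m + 1) * (m + 1) = t at *
    omega
  have hup : (α + (m + 1) - 1) / (m + 1) * m < α := by
    have h4 := Nat.div_mul_le_self (α + m - 1) m
    have h5 := Nat.mul_le_mul_right m (Nat.succ_le_of_lt hceil)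
    rw [Nat.succ_mul] at h5
    generalize (α + (m + 1) - 1) / (m + 1) * m = t at *
    omega
  generalize (α + (m + 1) - 1) / (m + 1) = n at *
  have hn : 0 < n := by
    rcases Nat.eq_zero_or_pos n with h0 | h0
    · subst h0; omega
    · exact h0
  obtain ⟨-, A, hA, hne⟩ := Oam_cover (m + 1) α n (Nat.succ_pos m) (by omega) hlow
  exact hne (nInt_transfer _ n (Oam_nInt m α n hup) ⟨0, hn⟩ A z fun i => hz _ (hA i))
end

section
/- (i) ¬(O^ω_1 ≤_L {{0}}), while {{0}} ≤_L O^ω_1; thus in the preorder of basic local operators the identity (induced by the family {{0}}) lies strictly below O^ω_1. (ii) For every nonempty family 𝒜 of subsets of ℕ, at least one of the following holds: ⋂𝒜 ≠ ∅ (so L(G_𝒜) is the identity); or ∅ ∈ 𝒜 (so L(G_𝒜) is the trivial local operator); or both O^ω_1 ≤_L 𝒜 and 𝒜 ≤_L {p ⊆ ℕ | p ≠ ∅} hold (the latter family inducing the double-negation operator). -/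
open scoped Classical

inductive Red14 : ℕ → ℕ → Prop
  | ret (v : ℕ) : Red14 (Nat.pair 0 v) v
  | step (e w v : ℕ) (hw : w ∈ kleene e 0) (h : Red14 w v) : Red14 (Nat.pair 1 e) v

theorem Red14.func {z v : ℕ} (h : Red14 z v) : ∀ v', Red14 z v' → v = v' := by
  induction h with
  | ret v =>
    intro v' h'
    generalize hz : Nat.pair 0 v = z at h'
    cases h' with
    | ret => exact (Nat.pair_eq_pair.1 hz).2
    | step e w v hw h => exact absurd (Nat.pair_eq_pair.1 hz).1 (by decide)
  | step e w v hw h ih =>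
    intro v' h'
    generalize hz : Nat.pair 1 e = z at h'
    cases h' with
    | ret => exact absurd (Nat.pair_eq_pair.1 hz).1 (by decide)
    | step e' w' _ hw' h' =>
      obtain rfl := (Nat.pair_eq_pair.1 hz).2
      obtain rfl := Part.mem_unique hw hw'
      exact ih _ h'

theorem red14_of_mem {z : ℕ} {p : Set ℕ} (h : z ∈ L' (GA {({0} : Set ℕ)}) p) :
    ∃ v ∈ p, Red14 z v := by
  refine h {z | ∃ v ∈ p, Red14 z v} ⟨?_, ?_⟩
  · rintro x ⟨a, rfl, b, hb, rfl⟩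
    exact ⟨b, hb, .ret b⟩
  · rintro x ⟨a, rfl, b, hb, rfl⟩
    simp only [GA, Set.mem_iUnion] at hb
    obtain ⟨A, rfl, hb⟩ := hb
    obtain ⟨w, hw, v, hv, hr⟩ := hb 0 rfl
    exact ⟨v, hv, .step _ _ _ hw hr⟩

theorem compl_mem14 (n : ℕ) : ({n}ᶜ : Set ℕ) ∈ Oam ⊤ 1 := by
  have : seg ⊤ = Set.univ := rfl
  simp [Oam, this, ← Set.compl_eq_univ_diff]

theorem eq_compl14 {X : Set ℕ} (h : X ∈ Oam ⊤ 1) : ∃ n, X = {n}ᶜ := by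
  have hs : seg ⊤ = Set.univ := rfl
  obtain ⟨-, -, h⟩ := h
  rw [hs, ← Set.compl_eq_univ_diff, Set.ncard_eq_one] at h
  obtain ⟨n, hn⟩ := h
  exact ⟨n, by rw [← hn, compl_compl]⟩

theorem exists_code14 : ∃ e : ℕ, ∀ a, Nat.pair 0 a ∈ kleene e a := by
  have h : Nat.Partrec (fun a => Part.some (Nat.pair 0 a)) :=
    Nat.Partrec.of_primrec (Nat.Primrec.pair .zero .id)
  obtain ⟨c, hc⟩ := Nat.Partrec.Code.exists_code.1 h
  refine ⟨Encodable.encode c, fun a => ?_⟩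
  simp [kleene, hc]

theorem mem_L14 {e : ℕ} (he : ∀ a, Nat.pair 0 a ∈ kleene e a) {𝒜 : Set (Set ℕ)}
    {A p : Set ℕ} (hA : A ∈ 𝒜) (hp : A ⊆ p) : Nat.pair 1 e ∈ L' (GA 𝒜) p := by
  rintro q ⟨h0, h1⟩
  refine h1 ⟨1, rfl, e, ?_, rfl⟩
  simp only [GA, Set.mem_iUnion]
  exact ⟨A, hA, fun a ha => ⟨_, he a, h0 ⟨0, rfl, a, hp ha, rfl⟩⟩⟩

theorem stmt14 :
    ((¬ leL (Oam ⊤ 1) {({0} : Set ℕ)}) ∧ leL {({0} : Set ℕ)} (Oam ⊤ 1)) ∧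
    (∀ 𝒜 : Set (Set ℕ), 𝒜.Nonempty →
      (⋂₀ 𝒜).Nonempty ∨ (∅ : Set ℕ) ∈ 𝒜 ∨
        (leL (Oam ⊤ 1) 𝒜 ∧ leL 𝒜 {p : Set ℕ | p ≠ ∅})) := by
  refine ⟨⟨?_, ?_⟩, ?_⟩
  · rintro ⟨z, hz⟩
    obtain ⟨v, -, hv⟩ := red14_of_mem (hz _ (compl_mem14 0))
    obtain ⟨w, hw, hw'⟩ := red14_of_mem (hz _ (compl_mem14 v))
    exact hw (hv.func _ hw').symm
  · refine ⟨Nat.pair 0 0, ?_⟩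
    rintro A rfl q ⟨h0, -⟩
    exact h0 ⟨0, rfl, 0, rfl, rfl⟩
  · intro 𝒜 _
    by_cases h1 : (⋂₀ 𝒜).Nonempty
    · exact .inl h1
    by_cases h2 : (∅ : Set ℕ) ∈ 𝒜
    · exact .inr (.inl h2)
    obtain ⟨e, he⟩ := exists_code14
    refine .inr (.inr ⟨⟨Nat.pair 1 e, ?_⟩, ⟨Nat.pair 1 e, ?_⟩⟩)
    · intro X hX
      obtain ⟨n, rfl⟩ := eq_compl14 hX
      have hn : n ∉ ⋂₀ 𝒜 := fun h => h1 ⟨n, h⟩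
      simp only [Set.mem_sInter, not_forall] at hn
      obtain ⟨A, hA, hnA⟩ := hn
      refine mem_L14 he hA ?_
      rintro x hx rfl
      exact hnA hx
    · intro A hA
      exact mem_L14 (A := A) he (fun h => h2 (h ▸ hA)) subset_rfl
end

section
/- Let D ⊆ ℕ and 1 < 2m < α ≤ ω, and let χ_D : ℕ → ℕ be the characteristic function of D (χ_D(n) = 0 if n ∈ D, and 1 otherwise). If there exists a total recursive function ζ such that for every n ∈ ℕ there is a (ζ(n), O^α_m, {χ_D(n)})-dedicated sight, then D is computable. (In other words, the basic local operators L(G_{O^α_m}) do not force any noncomputable subset of ℕ to be decidable.) -/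
open scoped Classical

open Nat.Partrec (Code)

/-- basic relation: `a ∈ [α]` and applying `e` then `c` to `a` gives `v` within fuel `k`. -/
def RR (α : ℕ∞) (a : ℕ) (b : (Code × ℕ) × ℕ) : Prop :=
  a ∈ seg α ∧ (Code.evaln b.2.unpair.1
    (Denumerable.ofNat Code b.1.2.unpair.2.unpair.2) a).bind
      (fun w => Code.evaln b.2.unpair.1 b.1.1 w) = some b.2.unpair.2

/-- the test searched for. -/
def TT (α : ℕ∞) (m : ℕ) (b : (Code × ℕ) × ℕ) : Prop :=
  (b.1.2.unpair.1 = 0 ∧ b.2.unpair.2 = b.1.2.unpair.2) ∨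
  (¬ b.1.2.unpair.1 = 0 ∧
    m + 1 ≤ ((List.range b.2.unpair.1).filter (fun a => decide (RR α a b))).length)

theorem seg_prim (α : ℕ∞) : PrimrecPred (fun a => a ∈ seg α) := by
  induction α using WithTop.recTopCoe with
  | top =>
    refine PrimrecPred.of_eq (p := fun a : ℕ => a = a) (Primrec.eq.comp Primrec.id Primrec.id) ?_
    intro a; exact ⟨fun _ => trivial, fun _ => rfl⟩
  | coe n =>
    exact PrimrecPred.of_eq (p := fun a : ℕ => 1 ≤ a ∧ a ≤ n)
      ((Primrec.nat_le.comp (Primrec.const 1) Primrec.id).and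
        (Primrec.nat_le.comp Primrec.id (Primrec.const n))) (fun a => Iff.rfl)

theorem RR_prim (α : ℕ∞) : PrimrecRel (RR α) := by
  unfold PrimrecRel RR
  have hk : Primrec (fun p : ℕ × (Code × ℕ) × ℕ => p.2.2.unpair.1) :=
    Primrec.fst.comp (Primrec.unpair.comp (Primrec.snd.comp Primrec.snd))
  have hv : Primrec (fun p : ℕ × (Code × ℕ) × ℕ => p.2.2.unpair.2) :=
    Primrec.snd.comp (Primrec.unpair.comp (Primrec.snd.comp Primrec.snd))
  have hz : Primrec (fun p : ℕ × (Code × ℕ) × ℕ => p.2.1.2) :=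
    Primrec.snd.comp (Primrec.fst.comp Primrec.snd)
  have hc : Primrec (fun p : ℕ × (Code × ℕ) × ℕ => p.2.1.1) :=
    Primrec.fst.comp (Primrec.fst.comp Primrec.snd)
  have he : Primrec (fun p : ℕ × (Code × ℕ) × ℕ =>
      Denumerable.ofNat Code p.2.1.2.unpair.2.unpair.2) :=
    (Primrec.ofNat Code).comp (Primrec.snd.comp (Primrec.unpair.comp
      (Primrec.snd.comp (Primrec.unpair.comp hz))))
  refine ((seg_prim α).comp Primrec.fst).and (Primrec.eq.comp ?_ (Primrec.option_some.comp hv))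
  refine Primrec.option_bind ?_ ?_
  · exact Code.primrec_evaln.comp ((hk.pair he).pair Primrec.fst)
  · exact Code.primrec_evaln.comp
      (((hk.comp Primrec.fst).pair (hc.comp Primrec.fst)).pair Primrec.snd)

theorem TT_prim (α : ℕ∞) (m : ℕ) : PrimrecPred (TT α m) := by
  unfold TT
  have hk : Primrec (fun p : (Code × ℕ) × ℕ => p.2.unpair.1) :=
    Primrec.fst.comp (Primrec.unpair.comp Primrec.snd)
  have hv : Primrec (fun p : (Code × ℕ) × ℕ => p.2.unpair.2) :=
    Primrec.snd.comp (Primrec.unpair.comp Primrec.snd)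
  have hz : Primrec (fun p : (Code × ℕ) × ℕ => p.1.2.unpair) :=
    Primrec.unpair.comp (Primrec.snd.comp Primrec.fst)
  have h0 : PrimrecPred (fun p : (Code × ℕ) × ℕ => p.1.2.unpair.1 = 0) :=
    Primrec.eq.comp (Primrec.fst.comp hz) (Primrec.const 0)
  refine (h0.and (Primrec.eq.comp hv (Primrec.snd.comp hz))).or (h0.not.and ?_)
  refine Primrec.nat_le.comp (Primrec.const _) (Primrec.list_length.comp ?_)
  have := (RR_prim α).listFilter.comp (Primrec.list_range.comp hk) Primrec.id
  convert this using 3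
  rfl

theorem exists_code_TT (α : ℕ∞) (m : ℕ) : ∃ c : Code, ∀ z, Code.eval c z =
    (Nat.rfind (fun t => Part.some (decide (TT α m ((c, z), t))))).map (fun t => t.unpair.2) := by
  have hT : Computable (fun b => decide (TT α m b)) := by
    have := (TT_prim α m).decide.to_comp
    convert this
  have : Partrec₂ (fun (c : Code) (z : ℕ) =>
    (Nat.rfind (fun t => Part.some (decide (TT α m ((c, z), t))))).map (fun t => t.unpair.2)) := by
    have h1 : Partrec₂ (fun (a : Code × ℕ) (t : ℕ) => Part.some (decide (TT α m (a, t)))) :=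
      hT.partrec
    have h2 := Partrec.rfind h1
    exact h2.map ((Computable.snd.comp (Primrec.unpair.to_comp.comp Computable.snd)).to₂)
  obtain ⟨c, hc⟩ := Code.fixed_point₂ this
  exact ⟨c, fun z => congrFun hc z⟩

theorem exists_finset {α : ℕ∞} {m : ℕ} (h2 : (2 * m : ℕ) < α) {A : Set ℕ} (hA : A ∈ Oam α m) :
    ∃ T : Finset ℕ, T.card = m + 1 ∧ ∀ a ∈ T, a ∈ A := by
  obtain ⟨hs, hf, hc⟩ := hA
  by_cases hi : A.Infinite
  · obtain ⟨T, hT, hT2⟩ := hi.exists_subset_card_eq (m + 1)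
    exact ⟨T, hT2, fun a ha => hT ha⟩
  · have hfin : A.Finite := Set.not_infinite.1 hi
    have hsf : (seg α).Finite := by
      rw [← Set.diff_union_of_subset hs]; exact hf.union hfin
    have hcard : m + 1 ≤ A.ncard := by
      have e := Set.ncard_diff_add_ncard_of_subset hs hsf
      induction α using WithTop.recTopCoe with
      | top => exact absurd hsf (Set.infinite_univ (α := ℕ))
      | coe n =>
        have : (seg (n : ℕ∞)) = ((Finset.Icc 1 n : Finset ℕ) : Set ℕ) := by
          ext k; simp [seg]; rfl
        have h3 : (seg (n : ℕ∞)).ncard = n := by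
          rw [this, Set.ncard_coe_finset]; simp
        have h4 : 2 * m < n := Nat.cast_lt (α := ℕ∞).1 h2
        change (seg (n : ℕ∞) \ A).ncard = m at hc
        change (seg (n : ℕ∞) \ A).ncard + A.ncard = (seg (n : ℕ∞)).ncard at e
        omega
    rw [Set.ncard_eq_toFinset_card A hfin] at hcard
    obtain ⟨T, hT, hT2⟩ := Finset.exists_subset_card_eq hcard
    exact ⟨T, hT2, fun a ha => by simpa using hT ha⟩

theorem exists_fuel {α : ℕ∞} (c : Code) (e y : ℕ) (T : Finset ℕ)
    (h : ∀ a ∈ T, ∃ w ∈ kleene e a, y ∈ Code.eval c w) :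
    ∃ k, ∀ k' ≥ k, ∀ a ∈ T, a < k' ∧
      (Code.evaln k' (Denumerable.ofNat Code e) a).bind (fun w => Code.evaln k' c w) = some y := by
  induction T using Finset.induction_on with
  | empty => exact ⟨0, by simp⟩
  | insert a T ha ih =>
    obtain ⟨k, hk⟩ := ih (fun b hb => h b (Finset.mem_insert_of_mem hb))
    obtain ⟨w, hw, hy⟩ := h a (Finset.mem_insert_self _ _)
    obtain ⟨k1, hk1⟩ := Code.evaln_complete.1 hw
    obtain ⟨k2, hk2⟩ := Code.evaln_complete.1 hy
    refine ⟨k + k1 + k2 + a + 1, fun k' hk' b hb => ?_⟩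
    rcases Finset.mem_insert.1 hb with rfl | hb
    · refine ⟨by omega, ?_⟩
      have e1 := Code.evaln_mono (show k1 ≤ k' by omega) hk1
      have e2 := Code.evaln_mono (show k2 ≤ k' by omega) hk2
      rw [Option.mem_def] at e1 e2
      rw [e1]; exact e2
    · exact hk k' (by omega) b hb

theorem dedicated_eval {α : ℕ∞} {m : ℕ} (h2 : (2 * m : ℕ) < α) {c : Code}
    (hc : ∀ z, Code.eval c z =
      (Nat.rfind (fun t => Part.some (decide (TT α m ((c, z), t))))).map (fun t => t.unpair.2))
    (y : ℕ) (S : Sight) : ∀ z, Dedicated {0} (fun _ => Oam α m) {y} z S → 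
      Code.eval c z = Part.some y := by
  have key : ∀ z, (∀ t, TT α m ((c, z), t) → t.unpair.2 = y) → (∃ t, TT α m ((c, z), t)) →
      Code.eval c z = Part.some y := by
    intro z hu ⟨t, ht⟩
    obtain ⟨n, hn, -⟩ := Nat.rfind_min' (p := fun t => decide (TT α m ((c, z), t)))
      (m := t) (by simpa using ht)
    have hn' := Nat.rfind_spec hn
    rw [hc z, Part.eq_some_iff, Part.mem_map_iff]
    refine ⟨n, hn, hu n ?_⟩
    simpa using hn'
  induction S with
  | nil =>
    rintro z ⟨y', hy', rfl⟩
    obtain rfl : y' = y := hy'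
    apply key
    · rintro t (⟨-, h⟩ | ⟨h, -⟩)
      · simpa using h
      · simp at h
    · exact ⟨Nat.pair 0 y', Or.inl (by simp)⟩
  | node A σ ih =>
    rintro z ⟨n, -, e, rfl, hA, hs⟩
    have hev : ∀ a ∈ A, ∃ w ∈ kleene e a, Code.eval c w = Part.some y := by
      intro a ha
      obtain ⟨w, hw, hd⟩ := hs a ha
      exact ⟨w, hw, ih a ha w hd⟩
    apply key
    · rintro t (⟨h, -⟩ | ⟨-, h⟩)
      · simp at h
      · rw [← List.toFinset_card_of_nodup ((List.nodup_range).filter _)] at h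
        obtain ⟨hA1, hA2, hA3⟩ := hA
        have : ∃ a ∈ A, RR α a ((c, Nat.pair 1 (Nat.pair n e)), t) := by
          by_contra hcon
          push Not at hcon
          have hsub : ((((List.range t.unpair.1).filter
              (fun a => decide (RR α a ((c, Nat.pair 1 (Nat.pair n e)), t)))).toFinset : 
                Finset ℕ) : Set ℕ) ⊆ seg α \ A := by
            intro a ha
            simp at ha
            exact ⟨ha.2.1, fun haA => hcon a haA ha.2⟩
          have := Set.ncard_le_ncard hsub hA2
          rw [Set.ncard_coe_finset, hA3] at this
          dsimp only at h
          omega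
        obtain ⟨a, ha, -, hr⟩ := this
        obtain ⟨w, hw, hwy⟩ := hev a ha
        simp only [Nat.unpair_pair, Option.bind_eq_some_iff] at hr
        obtain ⟨w', hw', hr⟩ := hr
        have e1 : w' = w := Part.mem_unique (Code.evaln_sound hw') hw
        subst e1
        have e2 := Code.evaln_sound hr
        rw [hwy] at e2
        exact Part.mem_some_iff.1 e2
    · obtain ⟨T, hT, hTA⟩ := exists_finset h2 hA
      obtain ⟨k, hk⟩ := exists_fuel (α := α) c e y T (fun a ha => by
        obtain ⟨w, hw, hwy⟩ := hev a (hTA a ha)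
        exact ⟨w, hw, by rw [hwy]; exact Part.mem_some _⟩)
      refine ⟨Nat.pair k y, Or.inr ⟨by simp, ?_⟩⟩
      rw [← List.toFinset_card_of_nodup ((List.nodup_range).filter _), ← hT]
      apply Finset.card_le_card
      intro a ha
      have := hk k le_rfl a ha
      simp only [List.mem_toFinset, List.mem_filter, List.mem_range, Nat.unpair_pair,
        decide_eq_true_eq, RR]
      exact ⟨this.1, hA.1 (hTA a ha), this.2⟩

/-- Theorem 5.9: the basic local operators `L(G_{O^α_m})` (`1 < 2m < α ≤ ω`) do not
force any noncomputable set to be decidable. -/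
theorem stmt17 (D : Set ℕ) (m : ℕ) (α : ℕ∞) (h1 : 1 < 2 * m) (h2 : (2 * m : ℕ) < α)
    (ζ : ℕ → ℕ) (hζ : Computable ζ)
    (h : ∀ n : ℕ, ∃ S : Sight,
      Dedicated {0} (fun _ => Oam α m) {chiD D n} (ζ n) S) :
    ComputablePred (· ∈ D) := by
  obtain ⟨c, hc⟩ := exists_code_TT α m
  have hev : ∀ n, Code.eval c (ζ n) = Part.some (chiD D n) := by
    intro n
    obtain ⟨S, hS⟩ := h n
    exact dedicated_eval h2 hc _ S _ hS
  have hchi : Computable (chiD D) := by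
    have : Partrec (fun n => Code.eval c (ζ n)) :=
      Code.eval_part.comp (Computable.const c) hζ
    exact this.of_eq hev
  have h0 : ComputablePred (fun n => chiD D n = 0) := by
    refine ⟨fun n => inferInstance, ?_⟩
    have := (Primrec.eq (α := ℕ)).decide.to_comp.comp hchi (Computable.const 0)
    convert this
  refine h0.of_eq (fun n => ?_)
  simp only [chiD]
  split_ifs with hn <;> simp [hn]
end
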